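/- Let φ denote Euler's totient function and let k ≥ 1. If k is even, then B_k(H) is a free abelian group of rank (1/(2k))·Σ_{d ∣ k} φ(d)·n^{k/d} + (1/4)·(n+1)·n^{k/2}. If k is odd, then B_k(H) is isomorphic to the direct sum of a free abelian group of rank (1/(2k))·Σ_{d ∣ k} φ(d)·n^{k/d} − (1/2)·n^{(k+1)/2} and an elementary abelian 2-group (ℤ/2ℤ)^s of rank s = n^{(k+1)/2}. -/

import Mathlib

noncomputable section

namespace JT10

/-- The index set for the basis `a_1, b_1, …, a_g, b_g` of `H` (so `n = 2g`). -/
abbrev ι (g : ℕ) := Fin g ⊕ Fin g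

/-- Words of length `k` in the basis of `H`. -/
def Wd (g k : ℕ) := {w : List (ι g) // w.length = k}

/-- The degree-`k` part `T_k(H)` of the tensor algebra: the free abelian group on the
words of length `k`. -/
abbrev TkS (g k : ℕ) := Wd g k →₀ ℤ

/-- Cyclic rotation of a word. -/
def rotW {g k : ℕ} (w : Wd g k) : Wd g k := ⟨w.1.rotate 1, by simp [w.2]⟩

/-- Mirror image (reversal) of a word. -/
def revW {g k : ℕ} (w : Wd g k) : Wd g k := ⟨w.1.reverse, by simp [w.2]⟩

/-- The relations `w - (cyclic rotation of w)`, i.e. `T_k(H) ∩ [T(H), T(H)]`. -/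
def cycRel (g k : ℕ) : Submodule ℤ (TkS g k) :=
  Submodule.span ℤ
    {z | ∃ w : Wd g k, z = Finsupp.single w 1 - Finsupp.single (rotW w) 1}

/-- The degree-`k` cyclic tensors `C_k(H) = T_k(H)/(T_k(H) ∩ [T(H), T(H)])`. -/
abbrev CkS (g k : ℕ) := TkS g k ⧸ cycRel g k

/-- `Mir_k(H) ⊆ C_k(H)`: the subgroup generated by the classes of the tensors
`w + (-1)^{k+1} w̄`. -/
def MirS (g k : ℕ) : Submodule ℤ (CkS g k) :=
  Submodule.span ℤ
    {z | ∃ w : Wd g k, z = Submodule.Quotient.mk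
      (Finsupp.single w 1 + ((-1 : ℤ))^(k+1) • Finsupp.single (revW w) 1)}

/-- `B_k(H) = C_k(H)/Mir_k(H)`. -/
abbrev BkS (g k : ℕ) := CkS g k ⧸ MirS g k

section Count
variable {α : Type} {k : ℕ}

def sh (i : ZMod k) (f : ZMod k → α) : ZMod k → α := fun j => f (j + i)

theorem sh_sh (i j : ZMod k) (f : ZMod k → α) : sh i (sh j f) = sh (i + j) f := by
  funext x; simp [sh, add_assoc]

theorem sh_zero (f : ZMod k → α) : sh 0 f = f := by
  funext x; simp [sh]

theorem sh_eq_sh (a b : ZMod k) (f : ZMod k → α) : sh a f = sh b f ↔ sh (a - b) f = f := by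
  constructor
  · intro h
    have := congrArg (sh (-b)) h
    rw [sh_sh, sh_sh, neg_add_cancel, sh_zero] at this
    rwa [sub_eq_neg_add]
  · intro h
    have := congrArg (sh b) h
    rwa [sh_sh, add_sub_cancel] at this

def shS (α : Type) (k : ℕ) : Setoid (ZMod k → α) where
  r f f' := ∃ i, sh i f = f'
  iseqv := ⟨fun f => ⟨0, sh_zero f⟩, by
    rintro f _ ⟨i, rfl⟩; exact ⟨-i, by rw [sh_sh, neg_add_cancel, sh_zero]⟩, by
    rintro f _ _ ⟨i, rfl⟩ ⟨j, rfl⟩; exact ⟨j + i, by rw [sh_sh]⟩⟩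

abbrev Nk (α : Type) (k : ℕ) := Quotient (shS α k)

instance [Finite α] [NeZero k] : Finite (Nk α k) := by unfold Nk; infer_instance

theorem Nk_eq {f f' : ZMod k → α} :
    (Quotient.mk (shS α k) f = Quotient.mk (shS α k) f') ↔ ∃ i, sh i f = f' :=
  Quotient.eq

open Classical in
theorem count_fixed [Fintype α] [NeZero k] (τ : (ZMod k → α) → (ZMod k → α)) (σ : Nk α k → Nk α k)
    (h : ∀ f, σ (Quotient.mk (shS α k) f) = Quotient.mk (shS α k) (τ f)) [Fintype (Nk α k)] :
    ∑ i : ZMod k, Fintype.card {f : ZMod k → α // sh i f = τ f}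
      = k * Fintype.card {c : Nk α k // σ c = c} := by
  simp_rw [Fintype.card_subtype, Finset.card_filter]
  rw [Finset.sum_comm, Finset.mul_sum,
    ← Finset.sum_fiberwise Finset.univ (fun f => Quotient.mk (shS α k) f)]
  refine Finset.sum_congr rfl fun c _ => ?_
  by_cases hc : σ c = c
  · rw [if_pos hc, mul_one]
    obtain ⟨f0, rfl⟩ := Quotient.exists_rep c
    have key : ∀ f ∈ Finset.univ.filter (fun f => Quotient.mk (shS α k) f = Quotient.mk _ f0),
        (∑ i : ZMod k, if sh i f = τ f then 1 else 0) = 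
          ∑ i : ZMod k, if sh i f0 = f then 1 else 0 := by
      intro f hf
      simp only [Finset.mem_filter, Finset.mem_univ, true_and] at hf
      have h2 : Quotient.mk (shS α k) f0 = Quotient.mk _ (τ f) := by
        rw [← h, hf, hc]
      obtain ⟨a, rfl⟩ := Nk_eq.1 hf.symm
      obtain ⟨b, hb⟩ := Nk_eq.1 h2
      rw [← hb]
      refine Fintype.sum_equiv (Equiv.addRight (2 * a - b)) _ _ fun i => ?_
      have : (sh i (sh a f0) = sh b f0) ↔ (sh (Equiv.addRight (2 * a - b) i) f0 = sh a f0) := by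
        rw [sh_sh, sh_eq_sh, Equiv.coe_addRight, sh_eq_sh,
          show i + (2 * a - b) - a = i + a - b by ring]
      simp only [this]
    rw [Finset.sum_congr rfl key, Finset.sum_comm]
    have : ∀ i ∈ (Finset.univ : Finset (ZMod k)), (∑ f ∈ Finset.univ.filter (fun f => Quotient.mk (shS α k) f = Quotient.mk _ f0), if sh i f0 = f then 1 else 0) = 1 := by
      intro i _
      rw [Finset.sum_ite_eq, if_pos]
      simp only [Finset.mem_filter, Finset.mem_univ, true_and]
      exact (Nk_eq.2 ⟨i, rfl⟩).symm
    rw [Finset.sum_congr rfl this]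
    simp [ZMod.card]
  · rw [if_neg hc, mul_zero]
    refine Finset.sum_eq_zero fun f hf => Finset.sum_eq_zero fun i _ => ?_
    simp only [Finset.mem_filter, Finset.mem_univ, true_and] at hf
    rw [if_neg]
    intro hi
    apply hc
    rw [← hf, h, ← hi]
    exact (Nk_eq.2 ⟨i, rfl⟩).symm

open Classical in
theorem card_fix_sh [Fintype α] [NeZero k] (i : ZMod k) :
    Fintype.card {f : ZMod k → α // sh i f = f} = Fintype.card α ^ (k / addOrderOf i) := by
  have hq : Nat.card (ZMod k ⧸ AddSubgroup.zmultiples i) = k / addOrderOf i := by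
    have := AddSubgroup.card_eq_card_quotient_mul_card_addSubgroup (AddSubgroup.zmultiples i)
    rw [Nat.card_zmultiples, Nat.card_zmod] at this
    exact (Nat.div_eq_of_eq_mul_left (addOrderOf_pos i) this).symm
  have e : {f : ZMod k → α // sh i f = f} ≃ ((ZMod k ⧸ AddSubgroup.zmultiples i) → α) :=
    { toFun := fun f x => Quotient.liftOn' x f.1 (by
        intro a b hab
        rw [QuotientAddGroup.leftRel_apply, AddSubgroup.mem_zmultiples_iff] at hab
        obtain ⟨m, hm⟩ := hab
        have hp : Function.Periodic f.1 i := fun x => congrFun f.2 x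
        have := hp.zsmul m a
        rw [hm] at this
        rw [add_neg_cancel_left] at this
        exact this.symm)
      invFun := fun F => ⟨fun j => F (QuotientAddGroup.mk j), by
        funext j
        simp only [sh]
        congr 1
        rw [QuotientAddGroup.eq]
        rw [AddSubgroup.mem_zmultiples_iff]
        exact ⟨-1, by simp⟩⟩
      left_inv := fun f => by ext j; rfl
      right_inv := fun F => by
        funext x
        induction x using QuotientAddGroup.induction_on with
        | H z => rfl }
  rw [Fintype.card_congr e, Fintype.card_fun, ← hq, Nat.card_eq_fintype_card]

theorem sum_sh [Fintype α] [NeZero k] :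
    ∑ i : ZMod k, Fintype.card α ^ (k / addOrderOf i)
      = ∑ d ∈ Nat.divisors k, Nat.totient d * Fintype.card α ^ (k / d) := by
  classical
  rw [← Finset.sum_fiberwise_of_maps_to (s := Finset.univ) (t := Nat.divisors k) (g := fun i : ZMod k => addOrderOf i)]
  · refine Finset.sum_congr rfl fun d hd => ?_
    rw [Finset.sum_congr rfl (g := fun _ => Fintype.card α ^ (k / d))]
    · rw [Finset.sum_const, IsAddCyclic.card_addOrderOf_eq_totient, smul_eq_mul]
      rw [ZMod.card]; exact Nat.dvd_of_mem_divisors hd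
    · intro x hx; simp at hx; rw [hx]
  · intro i _
    rw [Nat.mem_divisors]
    refine ⟨?_, NeZero.ne k⟩
    have := addOrderOf_dvd_card (x := i)
    rwa [ZMod.card] at this

theorem card_invol {X : Type*} [Fintype X] [LinearOrder X] (τ : X → X) (h : ∀ x, τ (τ x) = x) :
    2 * Fintype.card {x // x ≤ τ x} = Fintype.card X + Fintype.card {x // τ x = x} ∧
    2 * Fintype.card {x // x < τ x} + Fintype.card {x // τ x = x} = Fintype.card X := by
  have e : Fintype.card {x // x < τ x} = Fintype.card {x // τ x < x} :=
    Fintype.card_congr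
    { toFun := fun x => ⟨τ x.1, by rw [h]; exact x.2⟩
      invFun := fun x => ⟨τ x.1, by rw [h]; exact x.2⟩
      left_inv := fun x => by simp [h]
      right_inv := fun x => by simp [h] }
  have e2 : Fintype.card {x // x ≤ τ x} = Fintype.card {x // x < τ x} + Fintype.card {x // τ x = x} := by
    simp_rw [Fintype.card_subtype]
    rw [← Finset.card_union_of_disjoint]
    · congr 1; ext x; simp [le_iff_lt_or_eq, eq_comm]
    · rw [Finset.disjoint_filter]; intro x _ hx hx'; exact hx.ne' hx'
  have e3 : Fintype.card {x // x ≤ τ x} + Fintype.card {x // τ x < x} = Fintype.card X := by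
    have := Fintype.card_subtype_compl (fun x => x ≤ τ x)
    simp only [not_le] at this
    have h2 := Fintype.card_subtype_le (fun x => x ≤ τ x)
    omega
  omega

open Classical in
theorem card_fun_invol {X : Type*} [Fintype X] [LinearOrder X] [Fintype α] (τ : X → X) (h : ∀ x, τ (τ x) = x) :
    Fintype.card {f : X → α // ∀ x, f (τ x) = f x} = Fintype.card α ^ Fintype.card {x // x ≤ τ x} := by
  rw [← Fintype.card_fun]
  refine Fintype.card_congr
    { toFun := fun f x => f.1 x.1
      invFun := fun F => ⟨fun x => if hx : x ≤ τ x then F ⟨x, hx⟩ else F ⟨τ x, by rw [h]; exact (not_le.1 hx).le⟩, ?_⟩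
      left_inv := ?_
      right_inv := ?_ }
  · intro x
    beta_reduce
    rcases lt_trichotomy x (τ x) with hx | hx | hx
    · have h1 : ¬ τ x ≤ τ (τ x) := by rw [h]; exact not_le.2 hx
      rw [dif_neg h1, dif_pos hx.le]
      congr 2; exact h x
    · have h1 : τ x ≤ τ (τ x) := by rw [h]; exact hx.ge
      rw [dif_pos h1, dif_pos hx.le]
      congr 2; exact hx.symm
    · have h1 : τ x ≤ τ (τ x) := by rw [h]; exact hx.le
      rw [dif_pos h1, dif_neg (not_le.2 hx)]
  · intro f
    ext x
    dsimp only
    split_ifs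
    · rfl
    · exact f.2 x
  · intro F
    funext x
    simp [x.2]

def rv (f : ZMod k → α) : ZMod k → α := fun j => f (-1 - j)

theorem ncard_invol {X : Type*} [Finite X] [LinearOrder X] (τ : X → X) (h : ∀ x, τ (τ x) = x) :
    2 * Nat.card {x // x ≤ τ x} = Nat.card X + Nat.card {x // τ x = x} ∧
    2 * Nat.card {x // x < τ x} + Nat.card {x // τ x = x} = Nat.card X := by
  have := Fintype.ofFinite X
  simp only [Nat.card_eq_fintype_card]
  exact card_invol τ h

theorem ncard_fun_invol {X : Type*} [Finite X] [LinearOrder X] [Finite α] (τ : X → X)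
    (h : ∀ x, τ (τ x) = x) :
    Nat.card {f : X → α // ∀ x, f (τ x) = f x} = Nat.card α ^ Nat.card {x // x ≤ τ x} := by
  classical
  have := Fintype.ofFinite X
  have := Fintype.ofFinite α
  have := card_fun_invol (α := α) τ h
  simpa only [← Nat.card_eq_fintype_card] using this

open Classical in
theorem card_rv [Fintype α] [NeZero k] (i : ZMod k) : 
    Fintype.card {f : ZMod k → α // sh i f = rv f} = Fintype.card α ^ ((k + Fintype.card {j : ZMod k // (i - 1) - j = j}) / 2) := by
  simp only [← Nat.card_eq_fintype_card]
  let _ : LinearOrder (ZMod k) := linearOrderOfSTO (WellOrderingRel (α := ZMod k))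
  have h : ∀ x : ZMod k, (i - 1) - ((i - 1) - x) = x := fun x => by ring
  have h1 := (ncard_invol (fun x : ZMod k => (i - 1) - x) h).1
  rw [Nat.card_zmod] at h1
  rw [← h1, Nat.mul_div_cancel_left _ two_pos, ← ncard_fun_invol _ h]
  refine Nat.card_congr (Equiv.subtypeEquivRight fun f => ?_)
  constructor
  · intro hf x
    have := congrFun hf (-1 - x)
    simp only [sh, rv] at this
    rw [show -1 - (-1 - x) = x by ring] at this
    rw [← this]; congr 1; ring
  · intro hf
    funext j
    simp only [sh, rv]
    rw [← hf]; congr 1; ring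

open Classical in
theorem sum_rv_odd [Fintype α] [NeZero k] (hk : Odd k) : 
    ∑ i : ZMod k, Fintype.card {f : ZMod k → α // sh i f = rv f} = k * Fintype.card α ^ ((k+1)/2) := by
  have hu : IsUnit (2 : ZMod k) := by
    have := (ZMod.isUnit_iff_coprime 2 k).2 (Nat.coprime_two_left.2 hk)
    simpa using this
  have : ∀ i : ZMod k, Fintype.card {j : ZMod k // (i - 1) - j = j} = 1 := by
    intro i
    rw [Fintype.card_eq_one_iff]
    obtain ⟨u, hu⟩ := hu
    have h2 : (2 : ZMod k) * (↑u⁻¹ : ZMod k) = 1 := by rw [← hu]; simp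
    refine ⟨⟨(↑u⁻¹ : ZMod k) * (i - 1), by linear_combination (1 - i) * h2⟩, ?_⟩
    rintro ⟨y, hy⟩
    ext
    dsimp only
    linear_combination (-(↑u⁻¹ : ZMod k)) * hy - y * h2
  simp_rw [card_rv, this]
  simp [ZMod.card]

open Classical in
theorem sum_rv_even [Fintype α] [NeZero k] (hk : Even k) : 
    2 * ∑ i : ZMod k, Fintype.card {f : ZMod k → α // sh i f = rv f}
      = k * ((Fintype.card α + 1) * Fintype.card α ^ (k/2)) := by
  simp_rw [card_rv]
  set p : ZMod k → ℕ := fun i => Fintype.card {j : ZMod k // (i - 1) - j = j} with hp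
  obtain ⟨m, hm⟩ := hk
  have hk0 := NeZero.ne k
  have hker : Fintype.card {j : ZMod k // j + j = 0} = 2 := by
    have : ((Finset.univ.filter fun j : ZMod k => j + j = 0)) = {0, (m : ZMod k)} := by
      ext j
      simp only [Finset.mem_filter, Finset.mem_univ, true_and, Finset.mem_insert,
        Finset.mem_singleton]
      constructor
      · intro hj
        have hv : ((j.val + j.val : ℕ) : ZMod k) = 0 := by push_cast; simpa using hj
        rw [ZMod.natCast_eq_zero_iff] at hv
        obtain ⟨c, hc⟩ := hv
        have hlt := ZMod.val_lt j
        have : c < 2 := by nlinarith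
        have hj' : j = ((j.val : ℕ) : ZMod k) := by simp
        interval_cases c
        · left; rw [hj', show j.val = 0 by omega]; simp
        · right; rw [hj', show j.val = m by omega]
      · rintro (rfl | rfl)
        · simp
        · rw [← Nat.cast_add, ← hm]; simp
    rw [Fintype.card_subtype, this, Finset.card_pair]
    intro h0
    have := (ZMod.natCast_eq_zero_iff m k).1 h0.symm
    have := Nat.le_of_dvd (by omega) this
    omega
  have h02 : ∀ i, p i = 0 ∨ p i = 2 := by
    intro i
    by_cases hi : ∃ j : ZMod k, (i - 1) - j = j
    · right
      obtain ⟨j, hj⟩ := hi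
      rw [← hker]
      refine Fintype.card_congr ((Equiv.subRight j).subtypeEquiv fun x => ?_)
      simp only [Equiv.subRight_apply]
      constructor
      · intro hx; linear_combination hj - hx
      · intro hx; linear_combination hj - hx
    · left
      rw [hp]; dsimp only
      rw [Fintype.card_eq_zero_iff]
      exact ⟨fun x => hi ⟨x.1, x.2⟩⟩
  have hsum : ∑ i, p i = k := by
    simp_rw [hp, Fintype.card_subtype, Finset.card_filter]
    rw [Finset.sum_comm]
    have : ∀ j ∈ (Finset.univ : Finset (ZMod k)), (∑ i : ZMod k, if i - 1 - j = j then 1 else 0) = 1 := by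
      intro j _
      have : ∀ i, (i - 1 - j = j) ↔ i = 2 * j + 1 := fun i => 
        ⟨fun h => by linear_combination h, fun h => by linear_combination h⟩
      simp_rw [this]
      simp
    rw [Finset.sum_congr rfl this]
    simp [ZMod.card]
  have hterm : ∀ i, 2 * Fintype.card α ^ ((k + p i)/2) + p i * Fintype.card α ^ (k/2) = 2 * Fintype.card α ^ (k/2) + p i * (Fintype.card α ^ (k/2) * Fintype.card α) := by
    intro i
    rcases h02 i with h | h <;> rw [h]
    · simp
    · rw [show (k + 2)/2 = k/2 + 1 by omega, pow_succ]; ring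
  have := Finset.sum_congr (s₁ := (Finset.univ : Finset (ZMod k))) rfl fun i _ => hterm i
  simp only [Finset.sum_add_distrib, ← Finset.mul_sum, ← Finset.sum_mul, hsum] at this
  simp [ZMod.card] at this
  change 2 * ∑ i, Fintype.card α ^ ((k + p i)/2) = _
  linarith

end Count
section Alg

theorem even_equiv {N B : Type*} [LinearOrder N] [AddCommGroup B] (b : N → B) (σ : N → N)
    (hσ : ∀ x, σ (σ x) = x) (hb : ∀ x, b (σ x) = b x)
    (hext : ∀ F G : B →ₗ[ℤ] B, (∀ x, F (b x) = G (b x)) → F = G)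
    (huniv : ∀ φ : N → ({x // x ≤ σ x} →₀ ℤ), (∀ x, φ (σ x) = φ x) →
      ∃ F : B →ₗ[ℤ] ({x // x ≤ σ x} →₀ ℤ), ∀ x, F (b x) = φ x) :
    Nonempty (B ≃ₗ[ℤ] ({x // x ≤ σ x} →₀ ℤ)) := by
  let rep : N → {x // x ≤ σ x} := fun x => if h : x ≤ σ x then ⟨x, h⟩ else
    ⟨σ x, by rw [hσ]; exact (not_le.1 h).le⟩
  have hrep : ∀ x, rep (σ x) = rep x := by
    intro x
    simp only [rep]
    rcases lt_trichotomy x (σ x) with hx | hx | hx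
    · have h1 : ¬ σ x ≤ σ (σ x) := by rw [hσ]; exact not_le.2 hx
      rw [dif_neg h1, dif_pos hx.le]
      ext; exact hσ x
    · have h1 : σ x ≤ σ (σ x) := by rw [hσ]; exact hx.ge
      rw [dif_pos h1, dif_pos hx.le]
      ext; exact hx.symm
    · have h1 : σ x ≤ σ (σ x) := by rw [hσ]; exact hx.le
      rw [dif_pos h1, dif_neg (not_le.2 hx)]
  have hbrep : ∀ x, b (rep x).1 = b x := by
    intro x
    simp only [rep]
    split_ifs
    · rfl
    · exact hb x
  obtain ⟨F, hF⟩ := huniv (fun x => Finsupp.single (rep x) 1) (fun x => by simp only [hrep])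
  let G : ({x // x ≤ σ x} →₀ ℤ) →ₗ[ℤ] B := Finsupp.linearCombination ℤ (fun y => b y.1)
  have hG : ∀ y, G (Finsupp.single y 1) = b y.1 := fun y => by
    simp [G, Finsupp.linearCombination_single]
  refine ⟨LinearEquiv.ofLinearMap F G ?_ ?_⟩
  · refine Finsupp.lhom_ext' fun y => LinearMap.ext_ring ?_
    simp only [LinearMap.comp_apply, Finsupp.lsingle_apply, LinearMap.id_apply, hG, hF]
    congr 1
    simp [rep, y.2]
  · refine hext _ _ fun x => ?_
    simp only [LinearMap.comp_apply, LinearMap.id_apply, hG, hF, hbrep]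

theorem odd_equiv {N B : Type*} [LinearOrder N] [AddCommGroup B] (b : N → B) (σ : N → N)
    (hσ : ∀ x, σ (σ x) = x) (hb : ∀ x, b (σ x) = - b x)
    (hext : ∀ F G : B →ₗ[ℤ] B, (∀ x, F (b x) = G (b x)) → F = G)
    (huniv : ∀ φ : N → ({x // x < σ x} →₀ ℤ) × ({x // σ x = x} →₀ ZMod 2),
      (∀ x, φ (σ x) = - φ x) →
      ∃ F : B →ₗ[ℤ] ({x // x < σ x} →₀ ℤ) × ({x // σ x = x} →₀ ZMod 2), ∀ x, F (b x) = φ x) :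
    Nonempty (B ≃ₗ[ℤ] ({x // x < σ x} →₀ ℤ) × ({x // σ x = x} →₀ ZMod 2)) := by
  let φ : N → ({x // x < σ x} →₀ ℤ) × ({x // σ x = x} →₀ ZMod 2) := fun x =>
    if h : x < σ x then (Finsupp.single ⟨x, h⟩ 1, 0) else
    if h' : σ x < x then (- Finsupp.single ⟨σ x, by rw [hσ]; exact h'⟩ 1, 0) else
      (0, Finsupp.single ⟨x, le_antisymm (not_lt.1 h) (not_lt.1 h')⟩ 1)
  have φ1 : ∀ x (h : x < σ x), φ x = (Finsupp.single ⟨x, h⟩ 1, 0) := fun x h => by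
    simp only [φ]; rw [dif_pos h]
  have φ2 : ∀ x (h : x < σ x), φ (σ x) = (- Finsupp.single ⟨x, h⟩ 1, 0) := fun x h => by
    have h1 : ¬ σ x < σ (σ x) := by rw [hσ]; exact not_lt.2 h.le
    have h2 : σ (σ x) < σ x := by rw [hσ]; exact h
    simp only [φ]; rw [dif_neg h1, dif_pos h2]
    congr 4
    exact hσ x
  have φ3 : ∀ x (h : σ x = x), φ x = (0, Finsupp.single ⟨x, h⟩ 1) := fun x h => by
    have h1 : ¬ x < σ x := by rw [h]; exact lt_irrefl _
    have h2 : ¬ σ x < x := by rw [h]; exact lt_irrefl _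
    simp only [φ]; rw [dif_neg h1, dif_neg h2]
  have hφ : ∀ x, φ (σ x) = - φ x := by
    intro x
    rcases lt_trichotomy x (σ x) with hx | hx | hx
    · rw [φ1 x hx, φ2 x hx]; simp
    · have h3 := φ3 x hx.symm
      rw [hx.symm, h3, Prod.neg_mk, neg_zero, ← Finsupp.single_neg]
      rfl
    · have h1 : σ x < σ (σ x) := by rw [hσ]; exact hx
      have e1 := φ1 _ h1
      have e2 := φ2 _ h1
      rw [hσ] at e2
      rw [e1, e2]; simp
  obtain ⟨F, hF⟩ := huniv φ hφ
  have h2 : ∀ y : {x // σ x = x}, (zmultiplesHom B (b y.1)) ((2 : ℕ) : ℤ) = 0 := by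
    intro y
    have := hb y.1
    rw [y.2] at this
    simp only [zmultiplesHom_apply]
    rw [Nat.cast_ofNat, two_zsmul]
    nth_rewrite 1 [this]
    exact neg_add_cancel _
  let G1 : ({x // x < σ x} →₀ ℤ) →ₗ[ℤ] B := Finsupp.linearCombination ℤ (fun y => b y.1)
  let G2 : ({x // σ x = x} →₀ ZMod 2) →ₗ[ℤ] B :=
    (Finsupp.liftAddHom (fun y : {x // σ x = x} => ZMod.lift 2 ⟨zmultiplesHom B (b y.1), h2 y⟩)).toIntLinearMap
  have hG1 : ∀ y, G1 (Finsupp.single y 1) = b y.1 := fun y => by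
    simp [G1, Finsupp.linearCombination_single]
  have hG2 : ∀ y, G2 (Finsupp.single y 1) = b y.1 := fun y => by
    simp only [G2, AddMonoidHom.coe_toIntLinearMap, Finsupp.liftAddHom_apply_single]
    have := ZMod.lift_coe 2 ⟨zmultiplesHom B (b y.1), h2 y⟩ 1
    simpa using this
  refine ⟨LinearEquiv.ofLinearMap F (G1.coprod G2) ?_ ?_⟩
  · refine LinearMap.prod_ext ?_ ?_
    · refine Finsupp.lhom_ext' fun y => LinearMap.ext_ring ?_
      simp only [LinearMap.comp_apply, Finsupp.lsingle_apply, LinearMap.id_apply,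
        LinearMap.inl_apply, LinearMap.coprod_apply, map_zero, add_zero,
        hG1, hF, φ1 y.1 y.2]
    · apply LinearMap.toAddMonoidHom_injective
      refine Finsupp.addHom_ext' fun y => AddMonoidHom.ext fun z => ?_
      have hz : ∀ z : ZMod 2, z = 0 ∨ z = 1 := by decide
      rcases hz z with rfl | rfl
      · simp only [map_zero]
      simp only [LinearMap.comp_apply, Finsupp.singleAddHom_apply, LinearMap.id_apply,
        AddMonoidHom.comp_apply, LinearMap.toAddMonoidHom_coe,
        LinearMap.inr_apply, LinearMap.coprod_apply, map_zero, zero_add,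
        hG2, hF, φ3 y.1 y.2]
  · refine hext _ _ fun x => ?_
    simp only [LinearMap.comp_apply, LinearMap.id_apply, hF]
    rcases lt_trichotomy x (σ x) with hx | hx | hx
    · rw [φ1 x hx, LinearMap.coprod_apply, hG1, map_zero, add_zero]
    · rw [φ3 x hx.symm, LinearMap.coprod_apply, hG2, map_zero, zero_add]
    · have h1 : σ x < σ (σ x) := by rw [hσ]; exact hx
      have e2 := φ2 _ h1
      rw [hσ] at e2
      rw [e2, LinearMap.coprod_apply, map_neg, hG1, map_zero, add_zero, hb, neg_neg]

theorem fun_equiv (M X : Type*) [AddCommGroup M] [Finite X] (r : ℕ) (h : Nat.card X = r) :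
    Nonempty ((X →₀ M) ≃ₗ[ℤ] (Fin r → M)) := by
  subst h
  exact ⟨(Finsupp.linearEquivFunOnFinite ℤ M X).trans
    (LinearEquiv.funCongrLeft ℤ M (Finite.equivFin X).symm)⟩

theorem even_main {N B : Type} [Finite N] [AddCommGroup B] (b : N → B) (σ : N → N)
    (hσ : ∀ x, σ (σ x) = x) (hb : ∀ x, b (σ x) = b x)
    (hext : ∀ F G : B →ₗ[ℤ] B, (∀ x, F (b x) = G (b x)) → F = G)
    (huniv : ∀ (A : Type) [AddCommGroup A] (φ : N → A), (∀ x, φ (σ x) = φ x) →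
      ∃ F : B →ₗ[ℤ] A, ∀ x, F (b x) = φ x) :
    ∃ r : ℕ, 2 * r = Nat.card N + Nat.card {x // σ x = x} ∧
      Nonempty (B ≃ₗ[ℤ] (Fin r → ℤ)) := by
  classical
  let _ : LinearOrder N := linearOrderOfSTO (WellOrderingRel (α := N))
  obtain ⟨e⟩ := even_equiv b σ hσ hb hext (huniv _)
  obtain ⟨e'⟩ := fun_equiv ℤ {x : N // x ≤ σ x} _ rfl
  exact ⟨_, (ncard_invol σ hσ).1, ⟨e.trans e'⟩⟩

theorem odd_main {N B : Type} [Finite N] [AddCommGroup B] (b : N → B) (σ : N → N)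
    (hσ : ∀ x, σ (σ x) = x) (hb : ∀ x, b (σ x) = - b x)
    (hext : ∀ F G : B →ₗ[ℤ] B, (∀ x, F (b x) = G (b x)) → F = G)
    (huniv : ∀ (A : Type) [AddCommGroup A] (φ : N → A), (∀ x, φ (σ x) = - φ x) →
      ∃ F : B →ₗ[ℤ] A, ∀ x, F (b x) = φ x) (s : ℕ) (hs : Nat.card {x // σ x = x} = s) :
    ∃ r : ℕ, 2 * r + s = Nat.card N ∧
      Nonempty (B ≃ₗ[ℤ] ((Fin r → ℤ) × (Fin s → ZMod 2))) := by
  classical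
  let _ : LinearOrder N := linearOrderOfSTO (WellOrderingRel (α := N))
  obtain ⟨e⟩ := odd_equiv b σ hσ hb hext (huniv _)
  obtain ⟨e1⟩ := fun_equiv ℤ {x : N // x < σ x} _ rfl
  obtain ⟨e2⟩ := fun_equiv (ZMod 2) {x : N // σ x = x} _ hs
  refine ⟨_, ?_, ⟨e.trans (e1.prodCongr e2)⟩⟩
  rw [← hs]
  exact (ncard_invol σ hσ).2

end Alg

section Words

variable {g k : ℕ}

def toF [NeZero k] (w : Wd g k) : ZMod k → ι g := fun j => w.1[j.val]'(by
  rw [w.2]; exact ZMod.val_lt j)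

def ofF (f : ZMod k → ι g) : Wd g k := ⟨List.ofFn (fun i : Fin k => f (i.val : ZMod k)), by simp⟩

theorem toF_ofF [NeZero k] (f : ZMod k → ι g) : toF (ofF f) = f := by
  funext j
  simp [toF, ofF]

theorem ofF_toF [NeZero k] (w : Wd g k) : ofF (toF w) = w := by
  apply Subtype.ext
  apply List.ext_getElem
  · simp [ofF, w.2]
  · intro i h1 h2
    have : i < k := by rw [← w.2]; exact h2
    simp [toF, ofF, Nat.mod_eq_of_lt this]

theorem toF_rot [NeZero k] (w : Wd g k) : toF (rotW w) = sh 1 (toF w) := by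
  funext j
  simp only [toF, rotW, sh, List.getElem_rotate]
  congr 1
  rw [ZMod.val_add, ZMod.val_one_eq_one_mod, w.2]
  simp

theorem toF_rev [NeZero k] (w : Wd g k) : toF (revW w) = rv (toF w) := by
  funext j
  simp only [toF, revW, rv, List.getElem_reverse]
  congr 1
  rw [w.2]
  have hj := ZMod.val_lt j
  have : (-1 - j : ZMod k) = ((k - 1 - j.val : ℕ) : ZMod k) := by
    rw [Nat.sub_sub, Nat.cast_sub (by omega)]
    simp; ring
  rw [this, ZMod.val_natCast_of_lt (by omega)]

def cls (w : Wd g k) : BkS g k :=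
  Submodule.Quotient.mk (Submodule.Quotient.mk (Finsupp.single w 1))

theorem cls_rot (w : Wd g k) : cls (rotW w) = cls w := by
  unfold cls
  congr 1
  symm
  rw [Submodule.Quotient.eq]
  exact Submodule.subset_span ⟨w, rfl⟩

theorem cls_rev (w : Wd g k) : cls (revW w) = (-1 : ℤ) ^ k • cls w := by
  have h : cls w + (-1 : ℤ) ^ (k + 1) • cls (revW w) = 0 := by
    unfold cls
    rw [← Submodule.Quotient.mk_smul, ← Submodule.Quotient.mk_smul, ← Submodule.Quotient.mk_add,
      ← Submodule.Quotient.mk_add, Submodule.Quotient.mk_eq_zero]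
    exact Submodule.subset_span ⟨w, rfl⟩
  rcases neg_one_pow_eq_or ℤ k with h' | h'
  · rw [pow_succ, h'] at h
    rw [h', one_smul]
    rw [one_mul, neg_one_smul] at h
    exact (add_neg_eq_zero.1 h).symm
  · rw [pow_succ, h'] at h
    rw [h', neg_one_smul]
    rw [neg_one_mul, neg_neg, one_smul] at h
    exact (neg_eq_of_add_eq_zero_right h).symm

theorem cls_sh [NeZero k] (m : ℕ) (f : ZMod k → ι g) : cls (ofF (sh (m : ZMod k) f)) = cls (ofF f) := by
  induction m with
  | zero => simp [sh_zero]
  | succ m ih =>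
    rw [← ih, ← cls_rot (ofF (sh (m : ZMod k) f)), ← ofF_toF (rotW _), toF_rot, toF_ofF, sh_sh]
    congr 3
    push_cast; ring

def bN [NeZero k] : Nk (ι g) k → BkS g k :=
  Quotient.lift (fun f => cls (ofF f)) (by
    rintro f _ ⟨i, rfl⟩
    have := cls_sh i.val f
    rw [ZMod.natCast_zmod_val] at this
    exact this.symm)

theorem rv_sh {α : Type} (i : ZMod k) (f : ZMod k → α) : rv (sh i f) = sh (-i) (rv f) := by
  funext j; simp only [rv, sh]; congr 1; ring

theorem rv_rv {α : Type} (f : ZMod k → α) : rv (rv f) = f := by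
  funext j; simp only [rv]; congr 1; ring

def sg {α : Type} : Nk α k → Nk α k :=
  Quotient.map rv (by
    rintro f _ ⟨i, rfl⟩
    exact ⟨-i, (rv_sh i f).symm⟩)

theorem sg_mk {α : Type} (f : ZMod k → α) :
    sg (Quotient.mk (shS α k) f) = Quotient.mk (shS α k) (rv f) := rfl

theorem sg_sg {α : Type} (x : Nk α k) : sg (sg x) = x := by
  obtain ⟨f, rfl⟩ := Quotient.exists_rep x
  rw [sg_mk, sg_mk, rv_rv]

theorem bN_mk [NeZero k] (f : ZMod k → ι g) : bN (Quotient.mk (shS (ι g) k) f) = cls (ofF f) := rfl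

theorem bN_sg [NeZero k] (x : Nk (ι g) k) : bN (sg x) = (-1 : ℤ) ^ k • bN x := by
  obtain ⟨f, rfl⟩ := Quotient.exists_rep x
  rw [sg_mk, bN_mk, bN_mk, ← cls_rev, ← ofF_toF (revW _), toF_rev, toF_ofF]

theorem bN_ext [NeZero k] {A : Type*} [AddCommGroup A] (F G : BkS g k →ₗ[ℤ] A)
    (h : ∀ x, F (bN x) = G (bN x)) : F = G := by
  apply Submodule.linearMap_qext
  apply Submodule.linearMap_qext
  refine Finsupp.lhom_ext' fun w => LinearMap.ext_ring ?_
  have := h (Quotient.mk _ (toF w))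
  rw [bN_mk, ofF_toF] at this
  exact this

theorem bN_univ [NeZero k] {A : Type*} [AddCommGroup A] (φ : Nk (ι g) k → A)
    (h : ∀ x, φ (sg x) = (-1 : ℤ) ^ k • φ x) :
    ∃ F : BkS g k →ₗ[ℤ] A, ∀ x, F (bN x) = φ x := by
  let F0 : TkS g k →ₗ[ℤ] A :=
    Finsupp.linearCombination ℤ (fun w => φ (Quotient.mk _ (toF w)))
  have hF0 : ∀ w, F0 (Finsupp.single w 1) = φ (Quotient.mk _ (toF w)) := fun w => by
    simp [F0, Finsupp.linearCombination_single]
  have h0 : cycRel g k ≤ LinearMap.ker F0 := by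
    refine Submodule.span_le.2 ?_
    rintro _ ⟨w, rfl⟩
    rw [SetLike.mem_coe, LinearMap.mem_ker, map_sub, hF0, hF0, toF_rot, sub_eq_zero]
    congr 1
    exact Nk_eq.2 ⟨1, rfl⟩
  let F1 : CkS g k →ₗ[ℤ] A := (cycRel g k).liftQ F0 h0
  have h1 : MirS g k ≤ LinearMap.ker F1 := by
    refine Submodule.span_le.2 ?_
    rintro _ ⟨w, rfl⟩
    rw [SetLike.mem_coe, LinearMap.mem_ker]
    change F0 _ = 0
    rw [map_add, map_smul, hF0, hF0, toF_rev, ← sg_mk, h, smul_smul, ← pow_add,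
      show k + 1 + k = 2 * k + 1 by ring, pow_succ, pow_mul]
    simp
  refine ⟨(MirS g k).liftQ F1 h1, fun x => ?_⟩
  obtain ⟨f, rfl⟩ := Quotient.exists_rep x
  rw [bN_mk]
  change F0 _ = _
  rw [hF0, toF_ofF]

end Words

theorem card_Nk (g k : ℕ) [NeZero k] : k * Nat.card (Nk (ι g) k)
    = ∑ d ∈ Nat.divisors k, Nat.totient d * (2*g) ^ (k / d) := by
  classical
  have := Fintype.ofFinite (Nk (ι g) k)
  have h := count_fixed (α := ι g) (k := k) id id (fun _ => rfl)
  have hc : Fintype.card (ι g) = 2 * g := by simp [two_mul]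
  simp only [id, card_fix_sh] at h
  rw [sum_sh, hc] at h
  rw [h, Nat.card_eq_fintype_card]
  congr 1
  simp

theorem card_fix (g k : ℕ) [NeZero k] : 
    (Even k → 2 * (k * Nat.card {x : Nk (ι g) k // sg x = x}) = k * ((2*g+1) * (2*g)^(k/2))) ∧
    (Odd k → k * Nat.card {x : Nk (ι g) k // sg x = x} = k * (2*g)^((k+1)/2)) := by
  classical
  have := Fintype.ofFinite (Nk (ι g) k)
  have h := count_fixed (α := ι g) (k := k) rv sg (fun _ => rfl)
  have hc : Fintype.card (ι g) = 2 * g := by simp [two_mul]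
  have hh : Nat.card {x : Nk (ι g) k // sg x = x} = Fintype.card {x : Nk (ι g) k // sg x = x} :=
    Nat.card_eq_fintype_card
  rw [hh, ← h, ← hc]
  exact ⟨sum_rv_even, sum_rv_odd⟩

/-- **Statement 10.** Let `φ` be Euler's totient function, `n = 2g` and `k ≥ 1`. If `k` is
even, then `B_k(H)` is free abelian of rank
`(1/(2k))·∑_{d ∣ k} φ(d)·n^{k/d} + (1/4)·(n+1)·n^{k/2}`; if `k` is odd, then `B_k(H)` is the
direct sum of a free abelian group of rank
`(1/(2k))·∑_{d ∣ k} φ(d)·n^{k/d} − (1/2)·n^{(k+1)/2}` and of `(ℤ/2ℤ)^s` with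
`s = n^{(k+1)/2}` (the rank identities being stated multiplied out, to remain in `ℕ`). -/
theorem structure_of_Bk (g k : ℕ) (hg : 1 ≤ g) (hk : 1 ≤ k) :
    (Even k → ∃ r : ℕ,
      4 * k * r =
        2 * (∑ d ∈ Nat.divisors k, Nat.totient d * (2*g) ^ (k / d))
          + k * (2*g + 1) * (2*g) ^ (k / 2) ∧
      Nonempty (BkS g k ≃ₗ[ℤ] (Fin r → ℤ))) ∧
    (Odd k → ∃ r : ℕ,
      2 * k * r + k * (2*g) ^ ((k+1) / 2) =
        (∑ d ∈ Nat.divisors k, Nat.totient d * (2*g) ^ (k / d)) ∧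
      Nonempty (BkS g k ≃ₗ[ℤ]
        ((Fin r → ℤ) × (Fin ((2*g) ^ ((k+1) / 2)) → ZMod 2)))) := by
  have : NeZero k := ⟨by omega⟩
  have hN := card_Nk g k
  have hF := card_fix g k
  constructor
  · intro he
    obtain ⟨r, hr, e⟩ := even_main (bN : Nk (ι g) k → BkS g k) sg sg_sg
        (fun x => by rw [bN_sg, he.neg_one_pow, one_smul]) bN_ext
        (fun A _ φ hφ => bN_univ φ fun x => by rw [he.neg_one_pow, one_smul, hφ])
    refine ⟨r, ?_, e⟩
    have h1 := hF.1 he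
    rw [← hN]
    calc 4 * k * r = 2 * k * (2 * r) := by ring
      _ = 2 * (k * Nat.card (Nk (ι g) k))
          + 2 * (k * Nat.card {x : Nk (ι g) k // sg x = x}) := by rw [hr]; ring
      _ = _ := by rw [h1]; ring
  · intro ho
    have h1 := Nat.eq_of_mul_eq_mul_left (by omega) (hF.2 ho)
    obtain ⟨r, hr, e⟩ := odd_main (bN : Nk (ι g) k → BkS g k) sg sg_sg
        (fun x => by rw [bN_sg, ho.neg_one_pow, neg_one_smul]) bN_ext
        (fun A _ φ hφ => bN_univ φ fun x => by rw [ho.neg_one_pow, neg_one_smul, hφ]) _ h1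
    refine ⟨r, ?_, e⟩
    rw [← hN, ← hr]
    ring

end JT10
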